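/- Let d ≥ 1, ρ ∈ (0,2), and let W ∈ S_{2,ρ}(ℝ^d) satisfy: there exist constants C, R ∈ (0,∞) with W(x) ≤ -C|x|^{-ρ} for all x ∈ ℝ^d with |x| ≥ R. Let η = η₀ + η̃ be admissible with mean value η₀ < 0. Then N(0; ηW) < ∞, i.e. the Schrödinger operator -Δ + ηW has at most finitely many negative eigenvalues. -/

import Mathlib

open MeasureTheory Filter Real Set Topology

noncomputable section

abbrev Ed (d : ℕ) := EuclideanSpace ℝ (Fin d)

/-- Glazman variational count of eigenvalues of `-Δ + V` below `E`. -/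
noncomputable def schN (d : ℕ) (V : Ed d → ℝ) (E : ℝ) : ℕ∞ :=
  ⨆ F : {F : Submodule ℝ (Ed d → ℝ) //
      (∀ u ∈ F, ContDiff ℝ (⊤ : ℕ∞) u ∧ HasCompactSupport u) ∧
      (∀ u ∈ F, u ≠ 0 →
        (∫ x, (‖gradient u x‖ ^ 2 + V x * u x ^ 2)) < E * ∫ x, u x ^ 2)},
    (Module.finrank ℝ F.1 : ℕ∞)

/-- Laplacian. -/
noncomputable def lap (d : ℕ) (φ : Ed d → ℝ) (x : Ed d) : ℝ :=
  ∑ i : Fin d, iteratedFDeriv ℝ 2 φ x ![EuclideanSpace.single i 1, EuclideanSpace.single i 1]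

/-- The symbol class `S_{m,ρ}`. -/
def SClass (d m : ℕ) (ρ : ℝ) (W : Ed d → ℝ) : Prop :=
  ContDiff ℝ m W ∧ ∃ C : ℝ, 0 < C ∧ ∀ k : ℕ, k ≤ m → ∀ x : Ed d,
    ‖iteratedFDeriv ℝ k W x‖ ≤ C * (1 + ‖x‖) ^ (-ρ - (k : ℝ))

/-- The cube `(-R/2, R/2)^d`. -/
def cube (d : ℕ) (R : ℝ) : Set (Ed d) := {x | ∀ i, |x i| < R / 2}

/-- Admissibility of `η` with mean value `η₀` witnessed by the solution `φ` of `Δφ = η - η₀`. -/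
structure IsAdmissible (d : ℕ) (η : Ed d → ℝ) (η₀ : ℝ) (φ : Ed d → ℝ) : Prop where
  background_ne : ∃ x, η x ≠ η₀
  smooth : ContDiff ℝ 2 φ
  bounded : ∀ k : ℕ, k ≤ 2 → ∃ M : ℝ, ∀ x, ‖iteratedFDeriv ℝ k φ x‖ ≤ M
  poisson : ∀ x, lap d φ x = η x - η₀
  normalized : Filter.limsup (fun R : ℝ => (∫ x in cube d R, φ x) / R ^ d) Filter.atTop = 0

/-- Volume of the unit ball of `ℝ^d`. -/
noncomputable def tau (d : ℕ) : ℝ := (volume (Metric.ball (0 : Ed d) 1)).toReal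

/-- Semiclassical counting function. -/
noncomputable def Ncl (d : ℕ) (V : Ed d → ℝ) (E : ℝ) : ℝ :=
  (tau d / (2 * π) ^ d) * ∫ x, (max (E - V x) 0) ^ ((d : ℝ) / 2)


lemma sq_cs {X : Type*} [TopologicalSpace X] {u : X → ℝ} (h : HasCompactSupport u) :
    HasCompactSupport (fun x => u x ^ 2) := by
  apply h.mono
  intro x hx h0
  exact hx (by simp [h0])

lemma normsq_cs {X E : Type*} [TopologicalSpace X] [NormedAddCommGroup E] {u : X → E}
    (h : HasCompactSupport u) : HasCompactSupport (fun x => ‖u x‖ ^ 2) := by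
  apply h.mono
  intro x hx h0
  exact hx (by simp [h0])

lemma homothety_bound (d : ℕ) (A : Set (Ed d)) (hc : Convex ℝ A) (hm : MeasurableSet A)
    (g : Ed d → ENNReal) (hg : Measurable g) (y : Ed d) (hy : y ∈ A) (c : ℝ)
    (hc1 : 1/2 ≤ c) (hc2 : c ≤ 1) :
    ∫⁻ x in A, g (y + c • (x - y)) ≤ ENNReal.ofReal (2 ^ d) * ∫⁻ x in A, g x := by
  have hc0 : 0 < c := by linarith
  have hgi : Measurable (A.indicator g) := hg.indicator hm
  calc ∫⁻ x in A, g (y + c • (x - y))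
      = ∫⁻ x in A, A.indicator g (c • x + (y - c • y)) := by
        apply setLIntegral_congr_fun hm
        intro x hx
        have e : c • x + (y - c • y) = y + c • (x - y) := by rw [smul_sub]; abel
        have hmem : y + c • (x - y) ∈ A := by
          have := hc hy hx (a := 1 - c) (b := c) (by linarith) hc0.le (by ring)
          convert this using 1
          rw [smul_sub, sub_smul, one_smul]; abel
        simp only [e]
        rw [indicator_of_mem hmem]
    _ ≤ ∫⁻ x, A.indicator g (c • x + (y - c • y)) := setLIntegral_le_lintegral _ _
    _ = ∫⁻ x, A.indicator g (x + (y - c • y)) ∂(Measure.map (fun z : Ed d => c • z) volume) := by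
        rw [lintegral_map]
        · exact hgi.comp (measurable_id.add_const _)
        · exact measurable_const_smul c
    _ = ENNReal.ofReal |(c ^ d)⁻¹| * ∫⁻ x, A.indicator g x := by
        have := Measure.map_addHaar_smul (volume : Measure (Ed d)) hc0.ne'
        rw [show (fun z : Ed d => c • z) = (c • ·) from rfl, this, lintegral_smul_measure,
          lintegral_add_right_eq_self (A.indicator g)]
        simp [smul_eq_mul]
    _ ≤ ENNReal.ofReal (2 ^ d) * ∫⁻ x in A, g x := by
        rw [lintegral_indicator hm]
        gcongr
        rw [abs_of_pos (by positivity), ← inv_pow]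
        gcongr
        rw [inv_le_comm₀ hc0 (by norm_num)]; linarith

lemma line_bound (d : ℕ) (u : Ed d → ℝ) (hu : ContDiff ℝ 1 u) (x y : Ed d) :
    ENNReal.ofReal ((u x - u y) ^ 2) ≤ ENNReal.ofReal (‖x - y‖ ^ 2) *
      ∫⁻ t in Icc (0:ℝ) 1, ENNReal.ofReal (‖fderiv ℝ u (y + t • (x - y))‖ ^ 2) := by
  have hcf : Continuous (fderiv ℝ u) := hu.continuous_fderiv (by norm_num)
  have hline : Continuous (fun t : ℝ => y + t • (x - y)) := by fun_prop
  set f : ℝ → ℝ := fun t => fderiv ℝ u (y + t • (x - y)) (x - y) with hf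
  have hfc : Continuous f := (hcf.comp hline).clm_apply continuous_const
  have hder : ∀ t ∈ uIcc (0:ℝ) 1, HasDerivAt (fun t : ℝ => u (y + t • (x - y))) (f t) t := by
    intro t _
    have h1 : HasDerivAt (fun t : ℝ => y + t • (x - y)) (x - y) t := by
      simpa using ((hasDerivAt_id t).smul_const (x - y)).const_add y
    exact ((hu.differentiable (by norm_num)) _).hasFDerivAt.comp_hasDerivAt t h1
  have hftc := intervalIntegral.integral_eq_sub_of_hasDerivAt hder (hfc.intervalIntegrable 0 1)
  simp only [one_smul, zero_smul, add_zero, add_sub_cancel] at hftc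
  have hcs : (u x - u y) ^ 2 ≤ ∫ t in (0:ℝ)..1, f t ^ 2 := by
    set c := u x - u y
    have h0 : 0 ≤ ∫ t in (0:ℝ)..1, (f t - c) ^ 2 :=
      intervalIntegral.integral_nonneg (by norm_num) (fun t _ => sq_nonneg _)
    have h1 : ∫ t in (0:ℝ)..1, (f t - c) ^ 2 = (∫ t in (0:ℝ)..1, f t ^ 2) - 2 * c * (∫ t in (0:ℝ)..1, f t) + c ^ 2 := by
      have e : (fun t => (f t - c) ^ 2) = fun t => (f t ^ 2 - 2 * c * f t) + c ^ 2 := by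
        ext t; ring
      rw [e, intervalIntegral.integral_add, intervalIntegral.integral_sub,
        intervalIntegral.integral_const_mul]
      · simp
      all_goals apply Continuous.intervalIntegrable; fun_prop
    rw [h1, hftc] at h0
    nlinarith
  have hle : ∫ t in (0:ℝ)..1, f t ^ 2 ≤
      ‖x - y‖ ^ 2 * ∫ t in (0:ℝ)..1, ‖fderiv ℝ u (y + t • (x - y))‖ ^ 2 := by
    rw [← intervalIntegral.integral_const_mul]
    apply intervalIntegral.integral_mono_on (by norm_num)
    · apply Continuous.intervalIntegrable; fun_prop
    · apply Continuous.intervalIntegrable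
      exact continuous_const.mul ((hcf.comp hline).norm.pow 2)
    · intro t _
      have := (fderiv ℝ u (y + t • (x - y))).le_opNorm (x - y)
      have h2 := pow_le_pow_left₀ (norm_nonneg _) this 2
      rw [Real.norm_eq_abs, sq_abs] at h2
      simp only [hf]
      linarith [h2, mul_pow ‖fderiv ℝ u (y + t • (x - y))‖ ‖x-y‖ 2]
  have hcont : Continuous fun t : ℝ => ‖fderiv ℝ u (y + t • (x - y))‖ ^ 2 :=
    (hcf.comp hline).norm.pow 2
  rw [← ofReal_integral_eq_lintegral_ofReal hcont.integrableOn_Icc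
    (Eventually.of_forall fun t => by positivity), ← ENNReal.ofReal_mul (by positivity),
    integral_Icc_eq_integral_Ioc, ← intervalIntegral.integral_of_le (by norm_num)]
  exact ENNReal.ofReal_le_ofReal (hcs.trans hle)

lemma poincare (d : ℕ) (A : Set (Ed d)) (hc : Convex ℝ A) (hm : MeasurableSet A)
    (hvol : volume A ≠ ⊤) (D : ℝ) (hD : ∀ x ∈ A, ∀ y ∈ A, ‖x - y‖ ≤ D)
    (u : Ed d → ℝ) (hu : ContDiff ℝ 1 u) (hcs : HasCompactSupport u)
    (h0 : ∫ x in A, u x = 0) :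
    ∫ x in A, u x ^ 2 ≤ D ^ 2 * 2 ^ d * ∫ x in A, ‖fderiv ℝ u x‖ ^ 2 := by
  by_cases hv0 : volume A = 0
  · rw [Measure.restrict_eq_zero.2 hv0]; simp
  have hcf : Continuous (fderiv ℝ u) := hu.continuous_fderiv (by norm_num)
  have hui : IntegrableOn u A := (hu.continuous.integrable_of_hasCompactSupport hcs).integrableOn
  have hu2 : IntegrableOn (fun x => u x ^ 2) A := by
    apply Integrable.integrableOn
    apply (hu.continuous.pow 2).integrable_of_hasCompactSupport
    exact sq_cs hcs
  have hg2 : IntegrableOn (fun x => ‖fderiv ℝ u x‖ ^ 2) A := by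
    apply Integrable.integrableOn
    apply (hcf.norm.pow 2).integrable_of_hasCompactSupport
    exact normsq_cs (hcs.fderiv ℝ)
  have hconst (c : ℝ) : IntegrableOn (fun _ => c) A := integrableOn_const hvol
  set g : Ed d → ENNReal := fun x => ENNReal.ofReal (‖fderiv ℝ u x‖ ^ 2) with hg
  have hgm : Measurable g := (ENNReal.continuous_ofReal.comp (hcf.norm.pow 2)).measurable
  -- lower bound
  have hlow : ∀ y, volume A * ENNReal.ofReal (u y ^ 2) ≤
      ∫⁻ x in A, ENNReal.ofReal ((u x - u y) ^ 2) := by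
    intro y
    have e : (fun x => (u x - u y) ^ 2) = fun x => (u x ^ 2 - 2 * u y * u x) + u y ^ 2 := by
      ext t; ring
    have hi : IntegrableOn (fun x => (u x - u y) ^ 2) A := by
      rw [e]; exact (hu2.sub (hui.const_mul _)).add (hconst _)
    rw [← ofReal_integral_eq_lintegral_ofReal hi (Eventually.of_forall fun t => by positivity)]
    have : ∫ x in A, (u x - u y) ^ 2 = (∫ x in A, u x ^ 2) + (volume A).toReal * u y ^ 2 := by
      have i1 : IntegrableOn (fun x => u x ^ 2 - 2 * u y * u x) A := hu2.sub (hui.const_mul _)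
      rw [e, integral_add i1 (hconst _),
        integral_sub hu2 (hui.const_mul _), integral_const_mul, h0]
      simp [Measure.real]
    rw [this]
    conv_lhs => rw [← ENNReal.ofReal_toReal hvol]
    rw [← ENNReal.ofReal_mul (by positivity)]
    apply ENNReal.ofReal_le_ofReal
    have : 0 ≤ ∫ x in A, u x ^ 2 := integral_nonneg fun x => by positivity
    linarith
  have hmeas3 : Measurable fun p : (Ed d × Ed d) × ℝ => g (p.1.1 + p.2 • (p.1.2 - p.1.1)) :=
    hgm.comp (by fun_prop)
  -- slice bound
  have hS : ∀ t ∈ Icc (0:ℝ) 1, ∫⁻ y in A, ∫⁻ x in A, g (y + t • (x - y)) ≤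
      ENNReal.ofReal (2 ^ d) * (∫⁻ x in A, g x) * volume A := by
    intro t ht
    rw [← setLIntegral_const A]
    by_cases h : 1 / 2 ≤ t
    · apply setLIntegral_mono' hm
      intro y hy
      exact homothety_bound d A hc hm g hgm y hy t h ht.2
    · rw [lintegral_lintegral_swap]
      · apply setLIntegral_mono' hm
        intro x hx
        have := homothety_bound d A hc hm g hgm x hx (1 - t) (by linarith) (by linarith [ht.1])
        convert this using 3 with y
        congr 1
        simp only [smul_sub, sub_smul, one_smul]; abel
      · exact (hgm.comp (by fun_prop)).aemeasurable
  have hup : ∫⁻ y in A, ∫⁻ x in A, ENNReal.ofReal ((u x - u y) ^ 2) ≤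
      ENNReal.ofReal (D ^ 2) * (ENNReal.ofReal (2 ^ d) * (∫⁻ x in A, g x) * volume A) := by
    calc ∫⁻ y in A, ∫⁻ x in A, ENNReal.ofReal ((u x - u y) ^ 2)
        ≤ ∫⁻ y in A, ∫⁻ x in A, ENNReal.ofReal (D ^ 2) * ∫⁻ t in Icc (0:ℝ) 1, g (y + t • (x - y)) := by
          apply setLIntegral_mono' hm
          intro y hy
          apply setLIntegral_mono' hm
          intro x hx
          refine (line_bound d u hu x y).trans ?_
          gcongr
          exact hD x hx y hy
      _ = ENNReal.ofReal (D ^ 2) * ∫⁻ y in A, ∫⁻ x in A, ∫⁻ t in Icc (0:ℝ) 1, g (y + t • (x - y)) := by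
          rw [← lintegral_const_mul' _ _ ENNReal.ofReal_ne_top]
          congr 1; ext y
          rw [← lintegral_const_mul' _ _ ENNReal.ofReal_ne_top]
      _ = ENNReal.ofReal (D ^ 2) * ∫⁻ t in Icc (0:ℝ) 1, ∫⁻ y in A, ∫⁻ x in A, g (y + t • (x - y)) := by
          congr 1
          rw [lintegral_lintegral_swap (μ := volume.restrict (Icc (0:ℝ) 1))]
          · congr 1; ext y
            rw [lintegral_lintegral_swap]
            exact (hgm.comp (by fun_prop)).aemeasurable
          · apply Measurable.aemeasurable
            exact Measurable.lintegral_prod_right'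
              (f := fun q : (ℝ × Ed d) × Ed d => g (q.1.2 + q.1.1 • (q.2 - q.1.2)))
              (hgm.comp (by fun_prop))
      _ ≤ ENNReal.ofReal (D ^ 2) * ∫⁻ t in Icc (0:ℝ) 1, ENNReal.ofReal (2 ^ d) * (∫⁻ x in A, g x) * volume A := by
          exact mul_le_mul_right (setLIntegral_mono' measurableSet_Icc hS) _
      _ = _ := by
          rw [setLIntegral_const]; simp
  have hfin : volume A * ∫⁻ y in A, ENNReal.ofReal (u y ^ 2) ≤
      volume A * (ENNReal.ofReal (D ^ 2) * ENNReal.ofReal (2 ^ d) * (∫⁻ x in A, g x)) := by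
    rw [← lintegral_const_mul' _ _ hvol]
    calc _ ≤ ∫⁻ y in A, ∫⁻ x in A, ENNReal.ofReal ((u x - u y) ^ 2) := lintegral_mono hlow
      _ ≤ _ := hup
      _ = _ := by ring
  rw [ENNReal.mul_le_mul_iff_right hv0 hvol] at hfin
  rw [hg, ← ofReal_integral_eq_lintegral_ofReal hu2 (Eventually.of_forall fun t => by positivity),
    ← ofReal_integral_eq_lintegral_ofReal hg2 (Eventually.of_forall fun t => by positivity),
    ← ENNReal.ofReal_mul (by positivity), ← ENNReal.ofReal_mul (by positivity),
    ENNReal.ofReal_le_ofReal_iff] at hfin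
  · exact hfin
  · have : 0 ≤ ∫ x in A, ‖fderiv ℝ u x‖ ^ 2 := integral_nonneg fun x => by positivity
    positivity

/-- Grid cell of side `δ`. -/
def cell (d : ℕ) (δ : ℝ) (k : Fin d → ℤ) : Set (Ed d) :=
  {x | ∀ i, (k i : ℝ) * δ ≤ x i ∧ x i < ((k i : ℝ) + 1) * δ}

lemma cell_convex (d : ℕ) (δ : ℝ) (k : Fin d → ℤ) : Convex ℝ (cell d δ k) := by
  intro x hx y hy a b ha hb hab i
  have h1 := hx i
  have h2 := hy i
  have : (a • x + b • y) i ∈ Ico ((k i : ℝ) * δ) (((k i : ℝ) + 1) * δ) := by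
    have := (convex_Ico ((k i : ℝ) * δ) (((k i : ℝ) + 1) * δ)) (x := x i) h1 (y := y i) h2 ha hb hab
    simpa using this
  exact this

lemma cell_measurable (d : ℕ) (δ : ℝ) (k : Fin d → ℤ) : MeasurableSet (cell d δ k) := by
  unfold cell
  simp only [ofPred_forall]
  refine MeasurableSet.iInter fun i => ?_
  have hx : Measurable fun x : Ed d => x i := by fun_prop
  exact (measurableSet_le measurable_const hx).inter (measurableSet_lt hx measurable_const)

lemma cell_diam (d : ℕ) (δ : ℝ) (hδ : 0 < δ) (k : Fin d → ℤ) (x : Ed d) (hx : x ∈ cell d δ k)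
    (y : Ed d) (hy : y ∈ cell d δ k) : ‖x - y‖ ≤ √d * δ := by
  rw [EuclideanSpace.norm_eq]
  have : ∑ i, ‖(x - y) i‖ ^ 2 ≤ d * δ ^ 2 := by
    calc _ ≤ ∑ i : Fin d, δ ^ 2 := by
          apply Finset.sum_le_sum
          intro i _
          have h1 := hx i
          have h2 := hy i
          have : ‖(x - y) i‖ ≤ δ := by
            simp only [PiLp.sub_apply, Real.norm_eq_abs, abs_le]
            constructor <;> linarith
          gcongr
      _ = _ := by simp
  calc _ ≤ √(d * δ ^ 2) := Real.sqrt_le_sqrt this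
    _ = _ := by rw [Real.sqrt_mul (by positivity), Real.sqrt_sq hδ.le]

lemma cell_disjoint (d : ℕ) (δ : ℝ) (hδ : 0 < δ) (k l : Fin d → ℤ) (hkl : k ≠ l) :
    Disjoint (cell d δ k) (cell d δ l) := by
  rw [Set.disjoint_left]
  intro x hx hy
  apply hkl
  ext i
  have h1 := hx i
  have h2 := hy i
  have a : (k i : ℝ) < l i + 1 := by
    have := h1.1.trans_lt h2.2
    exact lt_of_mul_lt_mul_right this hδ.le
  have b : (l i : ℝ) < k i + 1 := by
    have := h2.1.trans_lt h1.2
    exact lt_of_mul_lt_mul_right this hδ.le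
  have a' : k i < l i + 1 := by exact_mod_cast a
  have b' : l i < k i + 1 := by exact_mod_cast b
  omega

lemma local_bound (d : ℕ) (r κ : ℝ) (hκ : 0 < κ) :
    ∃ (s : Finset (Fin d → ℤ)) (A : (Fin d → ℤ) → Set (Ed d)),
      ∀ u : Ed d → ℝ, ContDiff ℝ 1 u → HasCompactSupport u → (∀ k ∈ s, ∫ x in A k, u x = 0) →
        ∫ x in Metric.ball (0 : Ed d) r, u x ^ 2 ≤ κ * ∫ x, ‖fderiv ℝ u x‖ ^ 2 := by
  obtain ⟨δ, hδ, hδκ⟩ : ∃ δ : ℝ, 0 < δ ∧ (√d * δ) ^ 2 * 2 ^ d ≤ κ := by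
    have : Tendsto (fun δ : ℝ => (√d * δ) ^ 2 * 2 ^ d) (𝓝[>] 0) (𝓝 0) := by
      have hc : Continuous (fun δ : ℝ => (√d * δ) ^ 2 * 2 ^ d) := by fun_prop
      have := hc.tendsto 0
      simp only [mul_zero, ne_eq, OfNat.ofNat_ne_zero, not_false_eq_true, zero_pow, zero_mul] at this
      exact this.mono_left nhdsWithin_le_nhds
    obtain ⟨δ, h1, h2⟩ := ((this.eventually (ge_mem_nhds hκ)).and self_mem_nhdsWithin).exists
    exact ⟨δ, h2, h1⟩
  set N : ℤ := ⌈r / δ⌉ + 1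
  refine ⟨Fintype.piFinset fun _ => Finset.Icc (-N) N, cell d δ, ?_⟩
  intro u hu hcs h0
  set s : Finset (Fin d → ℤ) := Fintype.piFinset fun _ => Finset.Icc (-N) N
  have hcf : Continuous (fderiv ℝ u) := hu.continuous_fderiv (by norm_num)
  have hu2 : Integrable (fun x => u x ^ 2) :=
    (hu.continuous.pow 2).integrable_of_hasCompactSupport (sq_cs hcs)
  have hg2 : Integrable (fun x => ‖fderiv ℝ u x‖ ^ 2) :=
    (hcf.norm.pow 2).integrable_of_hasCompactSupport (normsq_cs (hcs.fderiv ℝ))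
  have hcover : Metric.ball (0 : Ed d) r ⊆ ⋃ k ∈ s, cell d δ k := by
    intro x hx
    rw [mem_ball_zero_iff] at hx
    simp only [mem_iUnion]
    refine ⟨fun i => ⌊x i / δ⌋, ?_, ?_⟩
    · rw [Fintype.mem_piFinset]
      intro i
      have hxi : |x i| ≤ r := by
        have := PiLp.norm_apply_le x i
        rw [Real.norm_eq_abs] at this; linarith
      have h1 : |x i / δ| ≤ r / δ := by
        rw [abs_div, abs_of_pos hδ]; gcongr
      rw [abs_le] at h1
      have h2 := Int.le_ceil (r / δ)
      rw [Finset.mem_Icc]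
      constructor
      · rw [Int.le_floor]; push_cast [N]; linarith
      · have : ⌊x i / δ⌋ ≤ ⌈r / δ⌉ := by
          have : ((⌊x i / δ⌋ : ℤ) : ℝ) ≤ (⌈r / δ⌉ : ℤ) := (Int.floor_le _).trans (by linarith)
          exact_mod_cast this
        omega
    · intro i
      have h1 := Int.floor_le (x i / δ)
      have h2 := Int.lt_floor_add_one (x i / δ)
      exact ⟨(le_div_iff₀ hδ).1 h1, (div_lt_iff₀ hδ).1 h2⟩
  have hms : ∀ k ∈ s, MeasurableSet (cell d δ k) := fun k _ => cell_measurable d δ k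
  have hdj : (↑s : Set (Fin d → ℤ)).Pairwise (Function.onFun Disjoint (cell d δ)) :=
    fun k _ l _ hkl => cell_disjoint d δ hδ k l hkl
  have hvol : ∀ k, volume (cell d δ k) ≠ ⊤ := by
    intro k
    apply ne_of_lt
    apply Bornology.IsBounded.measure_lt_top
    rw [Metric.isBounded_iff]
    exact ⟨√d * δ, fun x hx y hy => by rw [dist_eq_norm]; exact cell_diam d δ hδ k x hx y hy⟩
  calc ∫ x in Metric.ball (0 : Ed d) r, u x ^ 2
      ≤ ∫ x in ⋃ k ∈ s, cell d δ k, u x ^ 2 :=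
        setIntegral_mono_set hu2.integrableOn (Eventually.of_forall fun x => sq_nonneg _)
          (Eventually.of_forall hcover)
    _ = ∑ k ∈ s, ∫ x in cell d δ k, u x ^ 2 :=
        integral_biUnion_finset s hms hdj fun k _ => hu2.integrableOn
    _ ≤ ∑ k ∈ s, κ * ∫ x in cell d δ k, ‖fderiv ℝ u x‖ ^ 2 := by
        apply Finset.sum_le_sum
        intro k hk
        refine (poincare d _ (cell_convex d δ k) (cell_measurable d δ k) (hvol k) (√d * δ)
          (cell_diam d δ hδ k) u hu hcs (h0 k hk)).trans ?_
        gcongr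
    _ = κ * ∫ x in ⋃ k ∈ s, cell d δ k, ‖fderiv ℝ u x‖ ^ 2 := by
        rw [← Finset.mul_sum, integral_biUnion_finset s hms hdj fun k _ => hg2.integrableOn]
    _ ≤ κ * ∫ x, ‖fderiv ℝ u x‖ ^ 2 := by
        refine mul_le_mul_of_nonneg_left ?_ hκ.le
        exact setIntegral_le_integral hg2 (Eventually.of_forall fun x => by positivity)

lemma ibp (d : ℕ) (φ ψ : Ed d → ℝ) (hφ : ContDiff ℝ 2 φ) (hψ : ContDiff ℝ 1 ψ)
    (hcs : HasCompactSupport ψ) :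
    ∫ x, lap d φ x * ψ x =
      - ∫ x, ∑ i : Fin d, fderiv ℝ ψ x (EuclideanSpace.single i 1) * fderiv ℝ φ x (EuclideanSpace.single i 1) := by
  have hφ1 : ContDiff ℝ 1 (fderiv ℝ φ) := hφ.fderiv_right (by norm_num)
  have hφc : Continuous (fderiv ℝ φ) := hφ1.continuous
  have hφ2c : Continuous (fderiv ℝ (fderiv ℝ φ)) := hφ1.continuous_fderiv (by norm_num)
  have hψc : Continuous (fderiv ℝ ψ) := hψ.continuous_fderiv (by norm_num)
  set e : Fin d → Ed d := fun i => EuclideanSpace.single i 1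
  have hfd : ∀ i x, fderiv ℝ (fun y => fderiv ℝ φ y (e i)) x (e i) = fderiv ℝ (fderiv ℝ φ) x (e i) (e i) := by
    intro i x
    have h := (hφ1.differentiable (by norm_num) x).hasFDerivAt.clm_apply (hasFDerivAt_const (e i) x)
    rw [h.fderiv]
    simp
  have hlap : ∀ x, lap d φ x * ψ x = ∑ i, ψ x * fderiv ℝ (fun y => fderiv ℝ φ y (e i)) x (e i) := by
    intro x
    unfold lap
    rw [Finset.sum_mul]
    apply Finset.sum_congr rfl
    intro i _
    rw [iteratedFDeriv_two_apply, hfd, mul_comm]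
    simp [e]
  have cs1 : ∀ f : Ed d → ℝ, Continuous f → Integrable fun x => ψ x * f x := fun f hf =>
    (hψ.continuous.mul hf).integrable_of_hasCompactSupport hcs.mul_right
  have i1 : ∀ i, Integrable (fun x => ψ x * fderiv ℝ (fun y => fderiv ℝ φ y (e i)) x (e i)) := by
    intro i
    apply cs1
    simp only [hfd]
    fun_prop
  have i2 : ∀ i, Integrable (fun x => fderiv ℝ ψ x (e i) * fderiv ℝ φ x (e i)) := by
    intro i
    apply Continuous.integrable_of_hasCompactSupport
    · fun_prop
    · apply HasCompactSupport.mul_right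
      exact hcs.fderiv_apply ℝ (e i)
  simp only [hlap]
  rw [integral_finsetSum _ fun i _ => i1 i, integral_finsetSum _ fun i _ => i2 i,
    ← Finset.sum_neg_distrib]
  apply Finset.sum_congr rfl
  intro i _
  apply integral_mul_fderiv_eq_neg_fderiv_mul_of_integrable (i2 i) (i1 i)
  · apply cs1; fun_prop
  · intro x _; exact hψ.differentiable (by norm_num) x
  · intro x _
    exact (hφ1.clm_apply contDiff_const).differentiable (by norm_num) x

lemma norm_gradient_eq (d : ℕ) (u : Ed d → ℝ) (x : Ed d) : ‖gradient u x‖ = ‖fderiv ℝ u x‖ := by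
  unfold gradient
  exact LinearIsometryEquiv.norm_map _ _

lemma form_bound (d : ℕ) (W η φ : Ed d → ℝ) (η₀ M : ℝ) (hW : ContDiff ℝ 1 W)
    (hφ : ContDiff ℝ 2 φ) (hM : ∀ x, ‖fderiv ℝ φ x‖ ≤ M) (hp : ∀ x, lap d φ x = η x - η₀)
    (u : Ed d → ℝ) (hu : ContDiff ℝ 1 u) (hcs : HasCompactSupport u) :
    ∫ x, (1 / 2 * ‖fderiv ℝ u x‖ ^ 2 + (η₀ * W x - d * M * ‖fderiv ℝ W x‖
        - 2 * (d * M) ^ 2 * W x ^ 2) * u x ^ 2)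
      ≤ ∫ x, (‖gradient u x‖ ^ 2 + η x * W x * u x ^ 2) := by
  have hM0 : 0 ≤ M := (norm_nonneg _).trans (hM 0)
  have hWc := hW.continuous
  have huc := hu.continuous
  have hWd : Continuous (fderiv ℝ W) := hW.continuous_fderiv (by norm_num)
  have hud : Continuous (fderiv ℝ u) := hu.continuous_fderiv (by norm_num)
  have hφd : Continuous (fderiv ℝ φ) := hφ.continuous_fderiv (by norm_num)
  have hψ : ContDiff ℝ 1 (fun x => W x * u x ^ 2) := hW.mul (hu.pow 2)
  have hψcs : HasCompactSupport (fun x => W x * u x ^ 2) := (sq_cs hcs).mul_left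
  have hψd : Continuous (fderiv ℝ (fun x => W x * u x ^ 2)) := hψ.continuous_fderiv (by norm_num)
  have hlapc : Continuous (lap d φ) := by
    unfold lap
    apply continuous_finsetSum
    intro i _
    have : Continuous (iteratedFDeriv ℝ 2 φ) := hφ.continuous_iteratedFDeriv (by norm_num)
    fun_prop
  have hg2 : Integrable (fun x => ‖fderiv ℝ u x‖ ^ 2) :=
    (hud.norm.pow 2).integrable_of_hasCompactSupport (normsq_cs (hcs.fderiv ℝ))
  have hIu : ∀ f : Ed d → ℝ, Continuous f → Integrable fun x => f x * u x ^ 2 := fun f hf =>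
    (hf.mul (huc.pow 2)).integrable_of_hasCompactSupport (sq_cs hcs).mul_left
  have i3 : Integrable (fun x => lap d φ x * (W x * u x ^ 2)) :=
    (hlapc.mul hψ.continuous).integrable_of_hasCompactSupport hψcs.mul_left
  set e : Fin d → Ed d := fun i => EuclideanSpace.single i 1 with he
  have hen : ∀ i, ‖e i‖ = 1 := by intro i; simp [e]
  have i4 : Integrable (fun x => ∑ i, fderiv ℝ (fun x => W x * u x ^ 2) x (e i) * fderiv ℝ φ x (e i)) := by
    apply integrable_finsetSum
    intro i _
    apply Continuous.integrable_of_hasCompactSupport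
    · fun_prop
    · apply HasCompactSupport.mul_right
      exact hψcs.fderiv_apply ℝ (e i)
  have i0 : Integrable (fun x => ‖fderiv ℝ u x‖ ^ 2 + (η₀ * W x) * u x ^ 2) :=
    hg2.add (hIu _ (by fun_prop))
  have heq : ∫ x, (‖gradient u x‖ ^ 2 + η x * W x * u x ^ 2) =
      ∫ x, ((‖fderiv ℝ u x‖ ^ 2 + (η₀ * W x) * u x ^ 2)
        - ∑ i, fderiv ℝ (fun x => W x * u x ^ 2) x (e i) * fderiv ℝ φ x (e i)) := by
    rw [integral_sub i0 i4, sub_eq_add_neg, ← ibp d φ _ hφ hψ hψcs, ← integral_add i0 i3]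
    congr 1; ext x
    rw [norm_gradient_eq, hp]; ring
  rw [heq]
  apply integral_mono ((hg2.const_mul _).add (hIu _ (by fun_prop))) (i0.sub i4)
  intro x
  simp only [Pi.add_apply, Pi.sub_apply]
  have hder : ‖fderiv ℝ (fun x => W x * u x ^ 2) x‖ ≤
      ‖fderiv ℝ W x‖ * u x ^ 2 + 2 * |W x| * |u x| * ‖fderiv ℝ u x‖ := by
    have h1 := (hW.differentiable (by norm_num) x).hasFDerivAt
    have h2 := (hu.differentiable (by norm_num) x).hasFDerivAt
    have h3 := h1.mul (h2.pow 2)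
    have h4 : fderiv ℝ (fun x => W x * u x ^ 2) x = _ := h3.fderiv
    rw [h4]
    refine (norm_add_le _ _).trans ?_
    rw [add_comm]
    gcongr
    · rw [norm_smul, mul_comm]; simp
    · rw [norm_smul, norm_smul]; simp; apply le_of_eq; ring
  have hsum : ∑ i, fderiv ℝ (fun x => W x * u x ^ 2) x (e i) * fderiv ℝ φ x (e i) ≤
      d * M * ‖fderiv ℝ (fun x => W x * u x ^ 2) x‖ := by
    calc _ ≤ ∑ i : Fin d, M * ‖fderiv ℝ (fun x => W x * u x ^ 2) x‖ := by
          apply Finset.sum_le_sum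
          intro i _
          have a := (fderiv ℝ (fun x => W x * u x ^ 2) x).le_opNorm (e i)
          have b := (fderiv ℝ φ x).le_opNorm (e i)
          rw [hen, mul_one] at a b
          refine (le_abs_self _).trans ?_
          rw [abs_mul, mul_comm]
          exact mul_le_mul (b.trans (hM x)) a (abs_nonneg _) hM0
      _ = _ := by simp; ring
  have hA : 0 ≤ (d : ℝ) * M := by positivity
  have h5 := mul_le_mul_of_nonneg_left hder hA
  generalize (d : ℝ) * M = A at *
  have h6 := sq_nonneg (‖fderiv ℝ u x‖ - 2 * A * (|W x| * |u x|))
  have h7 : (|W x| * |u x|) ^ 2 = W x ^ 2 * u x ^ 2 := by rw [mul_pow, sq_abs, sq_abs]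
  have h8 : (‖fderiv ℝ u x‖ - 2 * A * (|W x| * |u x|)) ^ 2 = ‖fderiv ℝ u x‖ ^ 2
     - 4 * (A * |W x| * |u x| * ‖fderiv ℝ u x‖) + 4 * A ^ 2 * (W x ^ 2 * u x ^ 2) := by
    rw [← h7]; ring
  nlinarith

lemma potential_bound (d : ℕ) (ρ : ℝ) (hρ : 0 < ρ) (W : Ed d → ℝ) (hW : SClass d 2 ρ W)
    (C R : ℝ) (hC : 0 < C) (hR : 0 < R)
    (hWneg : ∀ x : Ed d, R ≤ ‖x‖ → W x ≤ -C * ‖x‖ ^ (-ρ)) (η₀ : ℝ) (hη₀ : η₀ < 0)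
    (A : ℝ) (hA : 0 ≤ A) :
    ∃ K r : ℝ, 0 < K ∧ ∀ x, - K * (Metric.ball (0 : Ed d) r).indicator 1 x ≤
      η₀ * W x - A * ‖fderiv ℝ W x‖ - 2 * A ^ 2 * W x ^ 2 := by
  obtain ⟨-, B, hB, hWB⟩ := hW
  have hW0 : ∀ x, |W x| ≤ B * (1 + ‖x‖) ^ (-ρ) := by
    intro x
    have := hWB 0 (by norm_num) x
    rw [norm_iteratedFDeriv_zero] at this
    simpa using this
  have hW1 : ∀ x, ‖fderiv ℝ W x‖ ≤ B * (1 + ‖x‖) ^ (-ρ - 1) := by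
    intro x
    have := hWB 1 (by norm_num) x
    rw [norm_iteratedFDeriv_one] at this
    simpa using this
  have hW0' : ∀ x, |W x| ≤ B := by
    intro x
    refine (hW0 x).trans ?_
    have := Real.rpow_le_one_of_one_le_of_nonpos (x := 1 + ‖x‖) (z := -ρ) (by simp) (by linarith)
    nlinarith
  have hW1' : ∀ x, ‖fderiv ℝ W x‖ ≤ B := by
    intro x
    refine (hW1 x).trans ?_
    have := Real.rpow_le_one_of_one_le_of_nonpos (x := 1 + ‖x‖) (z := -ρ - 1) (by simp) (by linarith)
    nlinarith
  have hlim : Tendsto (fun r : ℝ => A * B * r ^ (-1 : ℝ) + 2 * A ^ 2 * B ^ 2 * r ^ (-ρ)) atTop (𝓝 0) := by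
    have h1 := (tendsto_rpow_neg_atTop (y := 1) (by norm_num)).const_mul (A * B)
    have h2 := (tendsto_rpow_neg_atTop hρ).const_mul (2 * A ^ 2 * B ^ 2)
    simpa using h1.add h2
  have hev := hlim.eventually (ge_mem_nhds (show 0 < -η₀ * C by nlinarith))
  obtain ⟨r, hr⟩ := eventually_atTop.1 (hev.and (eventually_ge_atTop R))
  refine ⟨-η₀ * B + A * B + 2 * A ^ 2 * B ^ 2, r, ?_, ?_⟩
  · have : 0 < -η₀ * B := by nlinarith
    positivity
  intro x
  by_cases hx : x ∈ Metric.ball (0 : Ed d) r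
  · rw [indicator_of_mem hx]
    simp only [Pi.one_apply, mul_one]
    have h1 := abs_le.1 (hW0' x)
    have h2 : W x ^ 2 ≤ B ^ 2 := by rw [← sq_abs]; gcongr; exact hW0' x
    have h3 := mul_le_mul_of_nonneg_left (hW1' x) hA
    have h4 := mul_le_mul_of_nonneg_left h2 (show 0 ≤ 2 * A ^ 2 by positivity)
    nlinarith
  · rw [indicator_of_notMem hx, mul_zero]
    rw [mem_ball_zero_iff, not_lt] at hx
    obtain ⟨h1, h2⟩ := hr _ hx
    have hx0 : 0 < ‖x‖ := hR.trans_le h2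
    have hp : 0 < ‖x‖ ^ (-ρ) := Real.rpow_pos_of_pos hx0 _
    have a0 : |W x| ≤ B * ‖x‖ ^ (-ρ) := by
      refine (hW0 x).trans ?_
      refine mul_le_mul_of_nonneg_left ?_ hB.le
      exact Real.rpow_le_rpow_of_nonpos hx0 (by linarith) (by linarith)
    have a1 : ‖fderiv ℝ W x‖ ≤ B * (‖x‖ ^ (-ρ) * ‖x‖ ^ (-1 : ℝ)) := by
      refine (hW1 x).trans ?_
      rw [← Real.rpow_add hx0, ← sub_eq_add_neg]
      refine mul_le_mul_of_nonneg_left ?_ hB.le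
      exact Real.rpow_le_rpow_of_nonpos hx0 (by linarith) (by linarith)
    have a2 : W x ^ 2 ≤ B ^ 2 * (‖x‖ ^ (-ρ) * ‖x‖ ^ (-ρ)) := by
      rw [← sq_abs]
      calc _ ≤ (B * ‖x‖ ^ (-ρ)) ^ 2 := by gcongr
        _ = _ := by ring
    have a3 := hWneg x h2
    have b1 := mul_le_mul_of_nonneg_left a1 hA
    have b2 := mul_le_mul_of_nonneg_left a2 (show 0 ≤ 2 * A ^ 2 by positivity)
    have b3 := mul_le_mul_of_nonpos_left a3 hη₀.le
    have b4 := mul_le_mul_of_nonneg_left h1 hp.le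
    nlinarith

/-- Theorem 3.1 (i), case `η₀ < 0`: finiteness of the discrete spectrum of `-Δ + ηW`. -/
theorem finite_discrete_spectrum_negative_mean
    (d : ℕ) (hd : 1 ≤ d) (ρ : ℝ) (hρ : ρ ∈ Set.Ioo (0 : ℝ) 2)
    (W : Ed d → ℝ) (hW : SClass d 2 ρ W)
    (C R : ℝ) (hC : 0 < C) (hR : 0 < R)
    (hWneg : ∀ x : Ed d, R ≤ ‖x‖ → W x ≤ -C * ‖x‖ ^ (-ρ))
    (η φ : Ed d → ℝ) (η₀ : ℝ) (hη : IsAdmissible d η η₀ φ) (hη₀ : η₀ < 0) :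
    schN d (fun x => η x * W x) 0 < ⊤ := by
  obtain ⟨M, hM⟩ := hη.bounded 1 (by norm_num)
  simp only [norm_iteratedFDeriv_one] at hM
  have hM0 : 0 ≤ M := (norm_nonneg _).trans (hM 0)
  obtain ⟨K, r, hK, hP⟩ := potential_bound d ρ hρ.1 W hW C R hC hR hWneg η₀ hη₀ (d * M)
    (by positivity)
  obtain ⟨s, A, hs⟩ := local_bound d r (1 / (2 * K)) (by positivity)
  have hW1 : ContDiff ℝ 1 W := hW.1.of_le (by norm_num)
  have hWc := hW1.continuous
  have hWd : Continuous (fderiv ℝ W) := hW1.continuous_fderiv (by norm_num)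
  have key : ∀ u : Ed d → ℝ, ContDiff ℝ 1 u → HasCompactSupport u →
      (∀ k ∈ s, ∫ x in A k, u x = 0) →
      0 ≤ ∫ x, (‖gradient u x‖ ^ 2 + η x * W x * u x ^ 2) := by
    intro u hu hcs h0
    have huc := hu.continuous
    have hud : Continuous (fderiv ℝ u) := hu.continuous_fderiv (by norm_num)
    have hloc := hs u hu hcs h0
    refine le_trans ?_ (form_bound d W η φ η₀ M hW1 hη.smooth hM hη.poisson u hu hcs)
    have hg2 : Integrable (fun x => ‖fderiv ℝ u x‖ ^ 2) :=
      (hud.norm.pow 2).integrable_of_hasCompactSupport (normsq_cs (hcs.fderiv ℝ))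
    have hu2 : Integrable (fun x => u x ^ 2) :=
      (huc.pow 2).integrable_of_hasCompactSupport (sq_cs hcs)
    have hIu : ∀ f : Ed d → ℝ, Continuous f → Integrable fun x => f x * u x ^ 2 := fun f hf =>
      (hf.mul (huc.pow 2)).integrable_of_hasCompactSupport (sq_cs hcs).mul_left
    have hind : Integrable ((Metric.ball (0 : Ed d) r).indicator fun x => u x ^ 2) :=
      hu2.indicator measurableSet_ball
    calc (0 : ℝ) ≤ 1 / 2 * (∫ x, ‖fderiv ℝ u x‖ ^ 2)
          - K * ∫ x in Metric.ball (0 : Ed d) r, u x ^ 2 := by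
          have := mul_le_mul_of_nonneg_left hloc hK.le
          have e : K * (1 / (2 * K) * ∫ x, ‖fderiv ℝ u x‖ ^ 2) = 1 / 2 * ∫ x, ‖fderiv ℝ u x‖ ^ 2 := by
            field_simp
          linarith
      _ = ∫ x, (1 / 2 * ‖fderiv ℝ u x‖ ^ 2
            - K * (Metric.ball (0 : Ed d) r).indicator (fun x => u x ^ 2) x) := by
          rw [integral_sub (hg2.const_mul _) (hind.const_mul _), integral_const_mul,
            integral_const_mul, integral_indicator measurableSet_ball]
      _ ≤ _ := by
          apply integral_mono ((hg2.const_mul _).sub (hind.const_mul _))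
            ((hg2.const_mul _).add (hIu _ (by fun_prop)))
          intro x
          simp only [Pi.add_apply, Pi.sub_apply]
          have h1 := mul_le_mul_of_nonneg_right (hP x) (sq_nonneg (u x))
          have h2 : (Metric.ball (0 : Ed d) r).indicator (fun x => u x ^ 2) x =
              (Metric.ball (0 : Ed d) r).indicator 1 x * u x ^ 2 := by
            by_cases hx : x ∈ Metric.ball (0 : Ed d) r
            · simp only [indicator_of_mem hx, Pi.one_apply, one_mul]
            · simp only [indicator_of_notMem hx, zero_mul]
          rw [h2]
          linarith
  have hbound : schN d (fun x => η x * W x) 0 ≤ (s.card : ℕ∞) := by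
    unfold schN
    apply iSup_le
    rintro ⟨F, hF1, hF2⟩
    have hint : ∀ u : F, Integrable (u : Ed d → ℝ) := fun u =>
      (hF1 u u.2).1.continuous.integrable_of_hasCompactSupport (hF1 u u.2).2
    let L : F →ₗ[ℝ] (s → ℝ) :=
      { toFun := fun u k => ∫ x in A k, (u : Ed d → ℝ) x
        map_add' := by
          intro u v
          ext k
          exact integral_add (hint u).integrableOn (hint v).integrableOn
        map_smul' := by
          intro c u
          ext k
          exact integral_const_mul c _ }
    have hinj : Function.Injective L := by
      rw [← LinearMap.ker_eq_bot, LinearMap.ker_eq_bot']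
      intro u hu
      by_contra hne
      have hne' : (u : Ed d → ℝ) ≠ 0 := fun h => hne (Subtype.ext h)
      have h1 := hF2 u u.2 hne'
      have h2 := key u ((hF1 u u.2).1.of_le (by exact_mod_cast le_top)) (hF1 u u.2).2
        (fun k hk => congrFun hu ⟨k, hk⟩)
      rw [zero_mul] at h1
      exact absurd h1 (not_lt.2 h2)
    have := LinearMap.finrank_le_finrank_of_injective hinj
    rw [Module.finrank_fintype_fun_eq_card, Fintype.card_coe] at this
    exact_mod_cast this
  exact hbound.trans_lt (ENat.natCast_lt_top _)

end
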